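/- Let (ℋ, F', F'', (X₁,H₁,Y₁), (X₂,H₂,Y₂)) be a bi-sl₂-Hodge structure of central weight w on a finite-dimensional ℂ-vector space ℋ, polarized by a sesquilinear form S. Then (X₁+X₂, H₁+H₂, Y₁+Y₂) is again an sl₂-triple of endomorphisms of ℋ, it defines an sl₂-Hodge structure of central weight w on ℋ whose grading is the total grading ℋ^k = ⊕_{i+j=k} ℋ_{i,j}, and S polarizes this sl₂-Hodge structure. -/

import Mathlib

open Submodule

variable {H : Type} [AddCommGroup H] [Module ℂ H]

/-- An sl₂-Hodge structure of central weight `w` on `H`, presented by the family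
`P k p q` of subspaces `ℋ_k^{p,q}` (the `(p,q)`-piece of the weight `w+k` pure complex Hodge
structure on the `H`-eigenspace `ℋ_k`), together with an sl₂-triple `(X, Hh, Y)` acting as
morphisms of bidegree `(1,1)` resp. `(-1,-1)`. -/
structure IsSL2HodgeStructure (w : ℤ) (P : ℤ → ℤ → ℤ → Submodule ℂ H)
    (X Hh Y : Module.End ℂ H) : Prop where
  internal : DirectSum.IsInternal (fun t : ℤ × ℤ × ℤ => P t.1 t.2.1 t.2.2)
  finite : {t : ℤ × ℤ × ℤ | P t.1 t.2.1 t.2.2 ≠ ⊥}.Finite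
  weight : ∀ k p q : ℤ, P k p q ≠ ⊥ → p + q = w + k
  lie_HX : Hh * X - X * Hh = (2 : ℂ) • X
  lie_HY : Hh * Y - Y * Hh = (-2 : ℂ) • Y
  lie_XY : X * Y - Y * X = Hh
  semisimple : ∀ k p q : ℤ, ∀ x ∈ P k p q, Hh x = (k : ℂ) • x
  mapX : ∀ k p q : ℤ, (P k p q).map X ≤ P (k + 2) (p + 1) (q + 1)
  mapY : ∀ k p q : ℤ, (P k p q).map Y ≤ P (k - 2) (p - 1) (q - 1)

/-- A polarization of the sl₂-Hodge structure `(P, X, Hh, Y)` of central weight `w`: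
a Hermitian sesquilinear form `S` satisfying the adjunction relations, the orthogonality
relations between the graded Hodge pieces, and positivity of `(-1)^q S(X^k ·, ·)` on the
`(p,q)`-part of the primitive subspace `Pℋ₋ₖ = ker (X^(k+1)) ∩ ℋ₋ₖ` (this is the statement
that `S₋ₖ := S(X^k ·, ·)` polarizes the weight `w-k` pure Hodge structure `Pℋ₋ₖ`, the
positivity being twisted by the Deligne–Weil operator `C_D = (-1)^q`). -/
structure IsSL2Polarization (w : ℤ) (P : ℤ → ℤ → ℤ → Submodule ℂ H)
    (X Hh Y : Module.End ℂ H) (S : H → H → ℂ) : Prop where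
  add_left : ∀ x y z, S (x + y) z = S x z + S y z
  smul_left : ∀ (c : ℂ) (x y), S (c • x) y = c * S x y
  add_right : ∀ x y z, S x (y + z) = S x y + S x z
  smul_right : ∀ (c : ℂ) (x y), S x (c • y) = (starRingEnd ℂ) c * S x y
  hermitian : ∀ x y, S y x = (starRingEnd ℂ) (S x y)
  adj_H : ∀ x y, S (Hh x) y = -S x (Hh y)
  adj_X : ∀ x y, S (X x) y = S x (X y)
  adj_Y : ∀ x y, S (Y x) y = S x (Y y)
  orth : ∀ j p q j' p' q' : ℤ, (j + j' ≠ 0 ∨ p + q' ≠ w ∨ q + p' ≠ w) →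
    ∀ x ∈ P j p q, ∀ y ∈ P j' p' q', S x y = 0
  posdef : ∀ (k : ℕ) (p q : ℤ), ∀ x ∈ P (-(k : ℤ)) p q, (X ^ (k + 1)) x = 0 → x ≠ 0 →
    ∃ r : ℝ, 0 < r ∧ (-1 : ℂ) ^ q * S ((X ^ k) x) x = (r : ℂ)

/-- A bi-sl₂-Hodge structure of central weight `w` on `H`, presented by the family
`Q i j p q` of subspaces `ℋ_{i,j}^{p,q}` and two commuting sl₂-triples. -/
structure IsBiSL2HodgeStructure (w : ℤ) (Q : ℤ → ℤ → ℤ → ℤ → Submodule ℂ H)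
    (X₁ H₁ Y₁ X₂ H₂ Y₂ : Module.End ℂ H) : Prop where
  internal : DirectSum.IsInternal (fun t : (ℤ × ℤ) × ℤ × ℤ => Q t.1.1 t.1.2 t.2.1 t.2.2)
  finite : {t : (ℤ × ℤ) × ℤ × ℤ | Q t.1.1 t.1.2 t.2.1 t.2.2 ≠ ⊥}.Finite
  weight : ∀ i j p q : ℤ, Q i j p q ≠ ⊥ → p + q = w + i + j
  lie_HX₁ : H₁ * X₁ - X₁ * H₁ = (2 : ℂ) • X₁
  lie_HY₁ : H₁ * Y₁ - Y₁ * H₁ = (-2 : ℂ) • Y₁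
  lie_XY₁ : X₁ * Y₁ - Y₁ * X₁ = H₁
  lie_HX₂ : H₂ * X₂ - X₂ * H₂ = (2 : ℂ) • X₂
  lie_HY₂ : H₂ * Y₂ - Y₂ * H₂ = (-2 : ℂ) • Y₂
  lie_XY₂ : X₂ * Y₂ - Y₂ * X₂ = H₂
  comm : ∀ A ∈ ({X₁, H₁, Y₁} : Set (Module.End ℂ H)),
    ∀ B ∈ ({X₂, H₂, Y₂} : Set (Module.End ℂ H)), A * B = B * A
  semisimple₁ : ∀ i j p q : ℤ, ∀ x ∈ Q i j p q, H₁ x = (i : ℂ) • x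
  semisimple₂ : ∀ i j p q : ℤ, ∀ x ∈ Q i j p q, H₂ x = (j : ℂ) • x
  mapX₁ : ∀ i j p q : ℤ, (Q i j p q).map X₁ ≤ Q (i + 2) j (p + 1) (q + 1)
  mapY₁ : ∀ i j p q : ℤ, (Q i j p q).map Y₁ ≤ Q (i - 2) j (p - 1) (q - 1)
  mapX₂ : ∀ i j p q : ℤ, (Q i j p q).map X₂ ≤ Q i (j + 2) (p + 1) (q + 1)
  mapY₂ : ∀ i j p q : ℤ, (Q i j p q).map Y₂ ≤ Q i (j - 2) (p - 1) (q - 1)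

/-- A polarization of the bi-sl₂-Hodge structure `(Q, X₁, H₁, Y₁, X₂, H₂, Y₂)` of central
weight `w`: a Hermitian sesquilinear form satisfying the adjunction relations for both
triples, the orthogonality relations, and positivity of `(-1)^q S(X₁^i X₂^j ·, ·)` on the
`(p,q)`-part of the biprimitive subspace
`P₁P₂ℋ_{-i,-j} = ℋ_{-i,-j} ∩ ker X₁^(i+1) ∩ ker X₂^(j+1)`. -/
structure IsBiSL2Polarization (w : ℤ) (Q : ℤ → ℤ → ℤ → ℤ → Submodule ℂ H)
    (X₁ H₁ Y₁ X₂ H₂ Y₂ : Module.End ℂ H) (S : H → H → ℂ) : Prop where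
  add_left : ∀ x y z, S (x + y) z = S x z + S y z
  smul_left : ∀ (c : ℂ) (x y), S (c • x) y = c * S x y
  add_right : ∀ x y z, S x (y + z) = S x y + S x z
  smul_right : ∀ (c : ℂ) (x y), S x (c • y) = (starRingEnd ℂ) c * S x y
  hermitian : ∀ x y, S y x = (starRingEnd ℂ) (S x y)
  adj_H₁ : ∀ x y, S (H₁ x) y = -S x (H₁ y)
  adj_X₁ : ∀ x y, S (X₁ x) y = S x (X₁ y)
  adj_Y₁ : ∀ x y, S (Y₁ x) y = S x (Y₁ y)
  adj_H₂ : ∀ x y, S (H₂ x) y = -S x (H₂ y)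
  adj_X₂ : ∀ x y, S (X₂ x) y = S x (X₂ y)
  adj_Y₂ : ∀ x y, S (Y₂ x) y = S x (Y₂ y)
  orth : ∀ i j p q i' j' p' q' : ℤ,
    (i + i' ≠ 0 ∨ j + j' ≠ 0 ∨ p + q' ≠ w ∨ q + p' ≠ w) →
    ∀ x ∈ Q i j p q, ∀ y ∈ Q i' j' p' q', S x y = 0
  posdef : ∀ (i j : ℕ) (p q : ℤ), ∀ x ∈ Q (-(i : ℤ)) (-(j : ℤ)) p q,
    (X₁ ^ (i + 1)) x = 0 → (X₂ ^ (j + 1)) x = 0 → x ≠ 0 →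
    ∃ r : ℝ, 0 < r ∧ (-1 : ℂ) ^ q * S ((X₁ ^ i * X₂ ^ j) x) x = (r : ℂ)

/-- Relations of an `sl₂`-triple of elements of an associative ring, together with nilpotency of
the raising and lowering elements. -/
structure IsNilpotentSL2Triple {A : Type*} [Ring A] (X Hh Y : A) : Prop where
  weight_X : Hh * X = X * Hh + 2 * X
  weight_Y : Hh * Y = Y * Hh - 2 * Y
  commutator : X * Y = Y * X + Hh
  nilpotent_X : IsNilpotent X
  nilpotent_Y : IsNilpotent Y

section Ring

variable {A : Type*} [Ring A]

theorem IsNilpotentSL2Triple.symm {X Hh Y : A} (t : IsNilpotentSL2Triple X Hh Y) :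
    IsNilpotentSL2Triple Y (-Hh) X where
  weight_X := by rw [neg_mul, t.weight_Y]; noncomm_ring
  weight_Y := by rw [neg_mul, t.weight_X]; noncomm_ring
  commutator := by rw [t.commutator]; abel
  nilpotent_X := t.nilpotent_Y
  nilpotent_Y := t.nilpotent_X

theorem pow_mul_of_commutator {a b c d : A} (hab : a * b = b * a + c)
    (hac : a * c = c * a + (d + d)) (had : a * d = d * a) (n : ℕ) :
    a ^ (n + 2) * b = b * a ^ (n + 2) + (n + 2) • (c * a ^ (n + 1))
      + ((n + 2) * (n + 1)) • (d * a ^ n) := by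
  induction n with
  | zero =>
    have h : a * (b * a + c) = (a * b) * a + a * c := by noncomm_ring
    rw [pow_two, mul_assoc, hab, h, hab, hac]
    simp only [zero_add, pow_zero, pow_one, mul_one, add_mul, mul_assoc, two_smul]
    abel
  | succ n ih =>
    have h : a * (b * a ^ (n + 2) + (n + 2) • (c * a ^ (n + 1))
        + ((n + 2) * (n + 1)) • (d * a ^ n)) = (a * b) * a ^ (n + 2)
        + (n + 2) • ((a * c) * a ^ (n + 1)) + ((n + 2) * (n + 1)) • ((a * d) * a ^ n) := by
      simp only [mul_add, mul_smul_comm, mul_assoc]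
    rw [show n + 1 + 2 = (n + 2) + 1 from rfl, pow_succ', mul_assoc, ih, h, hab, hac, had]
    simp only [add_mul (_ : A), mul_assoc (_ : A), ← pow_succ', smul_add]
    module

variable [Module ℚ A]

theorem sum_exp_mul_of_commutator {a b c d : A} (hab : a * b = b * a + c)
    (hac : a * c = c * a + (d + d)) (had : a * d = d * a) (N : ℕ) :
    (∑ i ∈ Finset.range (N + 2), (i.factorial : ℚ)⁻¹ • a ^ i) * b =
      b * (∑ i ∈ Finset.range (N + 2), (i.factorial : ℚ)⁻¹ • a ^ i)
      + c * (∑ i ∈ Finset.range (N + 1), (i.factorial : ℚ)⁻¹ • a ^ i)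
      + d * (∑ i ∈ Finset.range N, (i.factorial : ℚ)⁻¹ • a ^ i) := by
  induction N with
  | zero => simp [Finset.sum_range_succ, add_mul, mul_add, hab]; abel
  | succ N ih =>
    have h1 : (((N + 2).factorial : ℚ)⁻¹ * ((N + 2 : ℕ) : ℚ)) = ((N + 1).factorial : ℚ)⁻¹ := by
      rw [Nat.factorial_succ (N + 1)]; push_cast; field_simp; ring
    have h2 : (((N + 2).factorial : ℚ)⁻¹ * (((N + 2) * (N + 1) : ℕ) : ℚ))
        = (N.factorial : ℚ)⁻¹ := by
      rw [Nat.factorial_succ (N + 1), Nat.factorial_succ N]; push_cast; field_simp; ring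
    have key : (((N + 2).factorial : ℚ)⁻¹ • a ^ (N + 2)) * b
        = b * (((N + 2).factorial : ℚ)⁻¹ • a ^ (N + 2))
        + c * (((N + 1).factorial : ℚ)⁻¹ • a ^ (N + 1)) + d * ((N.factorial : ℚ)⁻¹ • a ^ N) := by
      rw [smul_mul_assoc, pow_mul_of_commutator hab hac had, smul_add, smul_add,
        ← Nat.cast_smul_eq_nsmul ℚ, ← Nat.cast_smul_eq_nsmul ℚ, smul_smul, smul_smul, h1, h2]
      simp only [mul_smul_comm]
    rw [Finset.sum_range_succ _ (N + 2), add_mul, ih, key,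
      show Finset.range (N + 1 + 1) = Finset.range (N + 2) from rfl]
    generalize hs : ∑ i ∈ Finset.range (N + 2), (i.factorial : ℚ)⁻¹ • a ^ i = s
    rw [Finset.sum_range_succ] at hs
    rw [← hs, Finset.sum_range_succ _ N]
    simp only [mul_add]
    abel

theorem exp_mul_of_commutator {a b c d : A} (hab : a * b = b * a + c)
    (hac : a * c = c * a + (d + d)) (had : a * d = d * a) (ha : IsNilpotent a) :
    IsNilpotent.exp a * b = (b + c + d) * IsNilpotent.exp a := by
  obtain ⟨N, hN⟩ := ha
  have h := sum_exp_mul_of_commutator hab hac had N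
  rw [← IsNilpotent.exp_eq_sum hN, ← IsNilpotent.exp_eq_sum (pow_eq_zero_of_le (by omega) hN),
    ← IsNilpotent.exp_eq_sum (pow_eq_zero_of_le (by omega) hN)] at h
  rw [h, add_mul, add_mul]

theorem exp_commute_of_commute {a b : A} (h : Commute a b) : Commute (IsNilpotent.exp a) b := by
  rw [IsNilpotent.exp]
  exact (Commute.sum_right _ _ _ fun i _ => (h.symm.pow_right i).smul_right _).symm

/-- The element `exp X · exp (-Y) · exp X` representing the nontrivial Weyl group element. -/
noncomputable def weylElement (X Y : A) : A :=
  IsNilpotent.exp X * IsNilpotent.exp (-Y) * IsNilpotent.exp X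

namespace IsNilpotentSL2Triple

variable {X Hh Y : A} (t : IsNilpotentSL2Triple X Hh Y)
include t

theorem exp_X_mul_H :
    IsNilpotent.exp X * Hh = (Hh - 2 * X) * IsNilpotent.exp X := by
  rw [exp_mul_of_commutator (c := -(2 * X)) (d := 0) _ _ _ t.nilpotent_X]
  · rw [add_zero, sub_eq_add_neg]
  · rw [t.weight_X]; noncomm_ring
  · noncomm_ring
  · simp

theorem exp_X_mul_Y :
    IsNilpotent.exp X * Y = (Y + Hh - X) * IsNilpotent.exp X := by
  rw [exp_mul_of_commutator (c := Hh) (d := -X) t.commutator _ _ t.nilpotent_X]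
  · rw [sub_eq_add_neg]
  · rw [t.weight_X]; noncomm_ring
  · noncomm_ring

theorem exp_neg_Y_mul_H :
    IsNilpotent.exp (-Y) * Hh = (Hh - 2 * Y) * IsNilpotent.exp (-Y) := by
  rw [exp_mul_of_commutator (c := -(2 * Y)) (d := 0) _ _ _ t.nilpotent_Y.neg]
  · rw [add_zero, sub_eq_add_neg]
  · rw [mul_neg, t.weight_Y]; noncomm_ring
  · noncomm_ring
  · simp

theorem exp_neg_Y_mul_X :
    IsNilpotent.exp (-Y) * X = (X + Hh - Y) * IsNilpotent.exp (-Y) := by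
  rw [exp_mul_of_commutator (c := Hh) (d := -Y) _ _ _ t.nilpotent_Y.neg]
  · rw [sub_eq_add_neg]
  · rw [mul_neg, t.commutator]; noncomm_ring
  · rw [mul_neg, t.weight_Y]; noncomm_ring
  · noncomm_ring

theorem weylElement_mul_X : weylElement X Y * X = -(Y * weylElement X Y) := by
  have hX := (exp_commute_of_commute (Commute.refl X)).eq
  have hFX := t.exp_neg_Y_mul_X
  have hEH := t.exp_X_mul_H
  have hEY := t.exp_X_mul_Y
  unfold weylElement
  generalize IsNilpotent.exp X = E at *
  generalize IsNilpotent.exp (-Y) = F at *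
  calc E * F * E * X = E * (F * X) * E := by rw [mul_assoc, hX]; noncomm_ring
    _ = (E * X + E * Hh - E * Y) * F * E := by rw [hFX]; noncomm_ring
    _ = _ := by rw [hX, hEH, hEY]; noncomm_ring

theorem weylElement_mul_Y : weylElement X Y * Y = -(X * weylElement X Y) := by
  have hX := (exp_commute_of_commute (Commute.refl X)).eq
  have hY : IsNilpotent.exp (-Y) * Y = Y * IsNilpotent.exp (-Y) :=
    (exp_commute_of_commute (Commute.neg_left (Commute.refl Y))).eq
  have hFX := t.exp_neg_Y_mul_X
  have hFH := t.exp_neg_Y_mul_H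
  have hEY := t.exp_X_mul_Y
  unfold weylElement
  generalize IsNilpotent.exp X = E at *
  generalize IsNilpotent.exp (-Y) = F at *
  calc E * F * E * Y = E * (F * Y + F * Hh - F * X) * E := by
        rw [mul_assoc, hEY]; noncomm_ring
    _ = - (E * X) * F * E := by rw [hFX, hFH, hY]; noncomm_ring
    _ = _ := by rw [hX]; noncomm_ring

theorem weylElement_mul_H : weylElement X Y * Hh = -(Hh * weylElement X Y) := by
  have h : Hh = X * Y - Y * X := by rw [t.commutator]; abel
  have h1 : weylElement X Y * (X * Y) = Y * X * weylElement X Y := by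
    rw [← mul_assoc, t.weylElement_mul_X, neg_mul, mul_assoc, t.weylElement_mul_Y]; noncomm_ring
  have h2 : weylElement X Y * (Y * X) = X * Y * weylElement X Y := by
    rw [← mul_assoc, t.weylElement_mul_Y, neg_mul, mul_assoc, t.weylElement_mul_X]; noncomm_ring
  rw [h, mul_sub, h1, h2]; noncomm_ring

theorem exp_neg_X_mul_weylElement :
    IsNilpotent.exp (-X) * weylElement X Y = IsNilpotent.exp (-Y) * IsNilpotent.exp X := by
  rw [weylElement, mul_assoc, ← mul_assoc, IsNilpotent.exp_neg_mul_exp_self t.nilpotent_X, one_mul]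

end IsNilpotentSL2Triple

theorem weylElement_add {X₁ Y₁ X₂ Y₂ : A} (hX : Commute X₁ X₂) (hY : Commute Y₁ Y₂)
    (hXY : Commute X₁ Y₂) (hYX : Commute Y₁ X₂) (nX₁ : IsNilpotent X₁) (nX₂ : IsNilpotent X₂)
    (nY₁ : IsNilpotent Y₁) (nY₂ : IsNilpotent Y₂) :
    weylElement (X₁ + X₂) (Y₁ + Y₂) = weylElement X₁ Y₁ * weylElement X₂ Y₂ := by
  have key {a b : A} (h : Commute a b) : Commute (IsNilpotent.exp a) (IsNilpotent.exp b) :=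
    exp_commute_of_commute (exp_commute_of_commute h.symm).symm
  have h1 := (key hX).eq
  have h2 := (key hXY.neg_right).eq
  have h3 := (key hYX.neg_left).eq
  unfold weylElement
  rw [neg_add, IsNilpotent.exp_add_of_commute hX nX₁ nX₂,
    IsNilpotent.exp_add_of_commute hY.neg_left.neg_right nY₁.neg nY₂.neg]
  generalize IsNilpotent.exp X₁ = E₁ at *
  generalize IsNilpotent.exp (-Y₁) = F₁ at *
  generalize IsNilpotent.exp X₂ = E₂ at *
  generalize IsNilpotent.exp (-Y₂) = F₂ at *
  calc E₁ * E₂ * (F₁ * F₂) * (E₁ * E₂) = E₁ * (E₂ * F₁) * (F₂ * E₁) * E₂ := by noncomm_ring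
    _ = E₁ * F₁ * (E₂ * E₁) * F₂ * E₂ := by rw [← h3, ← h2]; noncomm_ring
    _ = _ := by rw [← h1]; noncomm_ring

theorem weylElement_commute {X Y a : A} (hX : Commute X a) (hY : Commute Y a) :
    Commute (weylElement X Y) a :=
  ((exp_commute_of_commute hX).mul_left
    (exp_commute_of_commute hY.neg_left)).mul_left (exp_commute_of_commute hX)

end Ring

section Representation

variable {V : Type*} [AddCommGroup V] [Module ℂ V]

/-- Endomorphisms of a complex vector space form a rational vector space. -/
noncomputable abbrev endModuleRat : Module ℚ (Module.End ℂ V) :=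
  Module.compHom (Module.End ℂ V) (algebraMap ℚ ℂ)

attribute [local instance] endModuleRat

theorem exp_apply_eq_sum {A : Module.End ℂ V} {N : ℕ} (h : A ^ N = 0) (x : V) :
    IsNilpotent.exp A x = ∑ i ∈ Finset.range N, (i.factorial : ℂ)⁻¹ • (A ^ i) x := by
  rw [IsNilpotent.exp_eq_sum h, LinearMap.sum_apply]
  refine Finset.sum_congr rfl fun i _ => ?_
  have : (i.factorial : ℚ)⁻¹ • A ^ i = (i.factorial : ℂ)⁻¹ • A ^ i := by
    change (algebraMap ℚ ℂ) (i.factorial : ℚ)⁻¹ • A ^ i = _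
    simp
  rw [this, LinearMap.smul_apply]

theorem exp_apply_of_apply_eq_zero {A : Module.End ℂ V} (hA : IsNilpotent A) {x : V}
    (hx : A x = 0) : IsNilpotent.exp A x = x := by
  obtain ⟨N, hN⟩ := hA
  rw [exp_apply_eq_sum (pow_eq_zero_of_le (Nat.le_succ N) hN), Finset.sum_range_succ',
    Finset.sum_eq_zero]
  · simp
  · intro i _
    rw [pow_succ, Module.End.mul_apply, hx, map_zero, smul_zero]

namespace IsNilpotentSL2Triple

variable {X Hh Y : Module.End ℂ V} (t : IsNilpotentSL2Triple X Hh Y)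
include t

theorem H_apply_X {μ : ℂ} {x : V} (hx : Hh x = μ • x) : Hh (X x) = (μ + 2) • X x := by
  have h := LinearMap.congr_fun t.weight_X x
  simp only [Module.End.mul_apply, LinearMap.add_apply, hx, map_smul, Module.End.ofNat_apply] at h
  rw [h]; module

theorem H_apply_X_pow {μ : ℂ} {x : V} (hx : Hh x = μ • x) (n : ℕ) :
    Hh ((X ^ n) x) = (μ + 2 * n) • (X ^ n) x := by
  induction n with
  | zero => simp [hx]
  | succ n ih =>
    rw [pow_succ', Module.End.mul_apply, t.H_apply_X ih]
    push_cast; ring_nf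

theorem H_apply_Y_pow {μ : ℂ} {x : V} (hx : Hh x = μ • x) (n : ℕ) :
    Hh ((Y ^ n) x) = (μ - 2 * n) • (Y ^ n) x := by
  have h := t.symm.H_apply_X_pow (μ := -μ) (x := x) (by simp [hx]) n
  rw [LinearMap.neg_apply, neg_eq_iff_eq_neg, ← neg_smul] at h
  rw [h]; ring_nf

theorem Y_apply_X_pow {μ : ℂ} {x : V} (hx : Hh x = μ • x) (n : ℕ) :
    Y ((X ^ (n + 1)) x) = (X ^ (n + 1)) (Y x) - ((n + 1) * (μ + n) : ℂ) • (X ^ n) x := by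
  have comm (y : V) : Y (X y) = X (Y y) - Hh y := by
    have h := LinearMap.congr_fun t.commutator y
    simp only [Module.End.mul_apply, LinearMap.add_apply] at h
    rw [h]; abel
  induction n with
  | zero => simp [comm, hx]
  | succ n ih =>
    rw [pow_succ' X (n + 1), Module.End.mul_apply, comm, ih, t.H_apply_X_pow hx, map_sub, map_smul,
      Module.End.mul_apply, ← Module.End.mul_apply X (X ^ n), ← pow_succ']
    push_cast
    module

theorem X_apply_Y_pow {μ : ℂ} {x : V} (hx : Hh x = μ • x) (n : ℕ) :
    X ((Y ^ (n + 1)) x) = (Y ^ (n + 1)) (X x) + ((n + 1) * (μ - n) : ℂ) • (Y ^ n) x := by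
  rw [t.symm.Y_apply_X_pow (μ := -μ) (by simp [hx])]
  module

theorem Y_pow_X_pow_of_lt {μ : ℂ} {x : V} (hx : Hh x = μ • x) (hY : Y x = 0) {a b : ℕ}
    (h : b < a) : (Y ^ a) ((X ^ b) x) = 0 := by
  induction b generalizing a with
  | zero =>
    obtain ⟨a, rfl⟩ := Nat.exists_eq_succ_of_ne_zero h.ne'
    rw [pow_zero, Module.End.one_apply, pow_succ, Module.End.mul_apply, hY, map_zero]
  | succ b ih =>
    obtain ⟨a, rfl⟩ := Nat.exists_eq_succ_of_ne_zero (Nat.ne_zero_of_lt h)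
    rw [Nat.succ_eq_add_one, pow_succ, Module.End.mul_apply, t.Y_apply_X_pow hx, hY, map_zero,
      zero_sub, map_neg, map_smul, ih (by omega), smul_zero, neg_zero]

theorem exists_Y_pow_X_pow {k : ℕ} {x : V} (hx : Hh x = (-k : ℂ) • x) (hY : Y x = 0) (a b : ℕ)
    (h : a + b ≤ k) : ∃ c : ℝ, 0 < c ∧ (Y ^ a) ((X ^ (a + b)) x) = (c : ℂ) • (X ^ b) x := by
  induction a with
  | zero => exact ⟨1, one_pos, by simp⟩
  | succ a ih =>
    obtain ⟨c, hc, e⟩ := ih (by omega)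
    have hk : (0 : ℝ) < k - (a + b) := by
      have : ((a + 1 + b : ℕ) : ℝ) ≤ k := by exact_mod_cast h
      push_cast at this
      linarith
    refine ⟨((a + b + 1) * (k - (a + b))) * c, by positivity, ?_⟩
    rw [show a + 1 + b = a + b + 1 by ring, pow_succ Y a, Module.End.mul_apply,
      t.Y_apply_X_pow hx, hY, map_zero, zero_sub, map_neg, map_smul, e, smul_smul, ← neg_smul]
    congr 1
    push_cast
    ring

theorem eq_zero_of_Y_pow {i : ℤ} {n : ℕ} (hn : (n : ℤ) ≤ i) {x : V} (hx : Hh x = (i : ℂ) • x)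
    (h : (Y ^ n) x = 0) : x = 0 := by
  obtain ⟨r, hr⟩ := t.nilpotent_X
  replace hr : (X ^ r) x = 0 := by rw [hr, LinearMap.zero_apply]
  induction r generalizing i n x with
  | zero => simpa using hr
  | succ r ih =>
    have hX : X x = 0 := by
      refine ih (i := i + 2) (n := n + 1) (by push_cast; omega) ?_ ?_ ?_
      · rw [t.H_apply_X hx]; push_cast; rfl
      · have e := t.X_apply_Y_pow hx n
        rw [pow_succ', Module.End.mul_apply, h, map_zero, map_zero, smul_zero, add_zero] at e
        rw [pow_succ']
        exact e.symm
      · rwa [pow_succ, Module.End.mul_apply] at hr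
    obtain ⟨k, rfl⟩ : ∃ k : ℕ, i = k := ⟨i.toNat, by omega⟩
    obtain ⟨c, hc, e⟩ := t.symm.exists_Y_pow_X_pow (k := k) (x := x) (by simp [hx]) hX n 0
      (by omega)
    rw [add_zero, h, map_zero, pow_zero, Module.End.one_apply, eq_comm, smul_eq_zero] at e
    exact e.resolve_left (by exact_mod_cast hc.ne')

theorem eq_zero_of_X_pow {i : ℤ} {n : ℕ} (hn : (n : ℤ) ≤ -i) {x : V} (hx : Hh x = (i : ℂ) • x)
    (h : (X ^ n) x = 0) : x = 0 :=
  t.symm.eq_zero_of_Y_pow hn (by simp [hx]) h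

theorem X_pow_succ_eq_zero {k : ℕ} {x : V} (hx : Hh x = (-k : ℂ) • x) (hY : Y x = 0) :
    (X ^ (k + 1)) x = 0 := by
  refine t.eq_zero_of_Y_pow (i := k + 2) (n := 1) (by omega) ?_ ?_
  · rw [t.H_apply_X_pow hx]; push_cast; ring_nf
  · rw [pow_one, t.Y_apply_X_pow hx, hY, map_zero]; simp

theorem Y_eq_zero_of_X_pow_succ {k : ℕ} {x : V} (hx : Hh x = (-k : ℂ) • x)
    (hX : (X ^ (k + 1)) x = 0) : Y x = 0 := by
  refine t.eq_zero_of_X_pow (i := -k - 2) (n := k + 2) (by push_cast; omega) ?_ ?_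
  · have := t.H_apply_Y_pow hx 1
    rw [pow_one] at this
    rw [this]; push_cast; ring_nf
  · have e := t.Y_apply_X_pow hx (k + 1)
    rw [pow_succ', Module.End.mul_apply, hX, map_zero, map_zero, smul_zero, sub_zero] at e
    rw [pow_succ', Module.End.mul_apply]
    exact e.symm

theorem weylElement_apply_of_Y_eq_zero {k : ℕ} {x : V} (hx : Hh x = (-k : ℂ) • x)
    (hY : Y x = 0) : weylElement X Y x = (k.factorial : ℂ)⁻¹ • (X ^ k) x := by
  set z := weylElement X Y x with hz
  have hXz : X z = 0 := by
    have := LinearMap.congr_fun t.weylElement_mul_Y x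
    simpa [hY, eq_comm] using this
  have hHz : Hh z = (k : ℂ) • z := by
    have := LinearMap.congr_fun t.weylElement_mul_H x
    simp only [Module.End.mul_apply, hx, LinearMap.neg_apply, map_smul, ← hz] at this
    rw [← neg_eq_iff_eq_neg] at this
    rw [← this]; module
  have hexp : IsNilpotent.exp Y z = IsNilpotent.exp X x := by
    have h1 := LinearMap.congr_fun t.exp_neg_X_mul_weylElement x
    rw [Module.End.mul_apply, ← hz, exp_apply_of_apply_eq_zero t.nilpotent_X.neg (by simp [hXz]),
      Module.End.mul_apply] at h1
    rw [h1, ← Module.End.mul_apply, IsNilpotent.exp_mul_exp_neg_self t.nilpotent_Y,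
      Module.End.one_apply]
  obtain ⟨M, hM⟩ := t.nilpotent_X
  obtain ⟨N, hN⟩ := t.nilpotent_Y
  rw [exp_apply_eq_sum (pow_eq_zero_of_le (show M ≤ k + 1 + M by omega) hM),
    exp_apply_eq_sum (pow_eq_zero_of_le (Nat.le_succ N) hN), Finset.sum_range_succ',
    Finset.sum_range_add, Finset.sum_range_succ] at hexp
  rw [Finset.sum_eq_zero (s := Finset.range M), add_zero] at hexp
  swap
  · intro i _
    rw [add_comm, pow_add, Module.End.mul_apply, t.X_pow_succ_eq_zero hx hY, map_zero, smul_zero]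
  rw [← sub_eq_zero]
  have hd := (Module.End.eigenspaces_iSupIndep Hh) (k : ℂ)
  refine Submodule.disjoint_def.1 hd _ ?_ ?_
  · refine Submodule.sub_mem _ (Module.End.mem_eigenspace_iff.2 hHz)
      (Submodule.smul_mem _ _ (Module.End.mem_eigenspace_iff.2 ?_))
    rw [t.H_apply_X_pow hx]; ring_nf
  · have e : z - (k.factorial : ℂ)⁻¹ • (X ^ k) x
        = ∑ i ∈ Finset.range k, (i.factorial : ℂ)⁻¹ • (X ^ i) x
          - ∑ i ∈ Finset.range N, ((i + 1).factorial : ℂ)⁻¹ • (Y ^ (i + 1)) z := by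
      simp only [Nat.factorial_zero, Nat.cast_one, inv_one, one_smul, pow_zero,
        Module.End.one_apply] at hexp
      rw [sub_eq_sub_iff_add_eq_add, add_comm, hexp]
    have mem {μ : ℂ} {v : V} (hμ : μ ≠ k) (hv : Hh v = μ • v) :
        v ∈ ⨆ j, ⨆ (_ : j ≠ (k : ℂ)), Hh.eigenspace j :=
      Submodule.mem_iSup_of_mem μ (Submodule.mem_iSup_of_mem hμ (Module.End.mem_eigenspace_iff.2 hv))
    rw [e]
    refine Submodule.sub_mem _ (Submodule.sum_mem _ fun i hi => Submodule.smul_mem _ _ ?_)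
      (Submodule.sum_mem _ fun i _ => Submodule.smul_mem _ _ ?_)
    · refine mem ?_ (t.H_apply_X_pow hx i)
      have := Finset.mem_range.1 hi
      intro h
      have : ((-k + 2 * i : ℤ) : ℂ) = ((k : ℤ) : ℂ) := by push_cast; exact h
      have := Int.cast_injective this
      omega
    · refine mem ?_ (t.H_apply_Y_pow hHz (i + 1))
      intro h
      have : ((k - 2 * (i + 1) : ℤ) : ℂ) = ((k : ℤ) : ℂ) := by push_cast at h ⊢; exact h
      have := Int.cast_injective this
      omega

theorem weylElement_apply_X_pow (a : ℕ) (x : V) :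
    weylElement X Y ((X ^ a) x) = (-1 : ℂ) ^ a • (Y ^ a) (weylElement X Y x) := by
  induction a with
  | zero => simp
  | succ a ih =>
    rw [pow_succ', Module.End.mul_apply, ← Module.End.mul_apply, t.weylElement_mul_X,
      LinearMap.neg_apply, Module.End.mul_apply, ih, map_smul, pow_succ' Y, Module.End.mul_apply,
      pow_succ']
    module

theorem exists_lowest_decomposition {G : ℤ → Submodule ℂ V} {i₀ : ℤ}
    (hX : ∀ s, ∀ x ∈ G s, X x ∈ G (s + 1)) (hY : ∀ s, ∀ x ∈ G s, Y x ∈ G (s - 1))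
    (hH : ∀ s, ∀ x ∈ G s, Hh x = ((i₀ + 2 * s : ℤ) : ℂ) • x) (n : ℕ) {s : ℤ} {x : V}
    (hx : x ∈ G s) (hn : (Y ^ n) x = 0) :
    ∃ u : ℕ → V, (∀ a : ℕ, u a ∈ G (s - a) ∧ Y (u a) = 0) ∧
      x = ∑ a ∈ Finset.range n, (X ^ a) (u a) := by
  have hXp (a : ℕ) : ∀ s, ∀ x ∈ G s, (X ^ a) x ∈ G (s + a) := by
    induction a with
    | zero => intro s x hx; simpa using hx
    | succ a ih =>
      intro s x hx
      rw [pow_succ', Module.End.mul_apply]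
      have := hX _ _ (ih s x hx)
      rwa [show s + a + 1 = s + (a + 1 : ℕ) by push_cast; ring] at this
  have hYp (a : ℕ) : ∀ s, ∀ x ∈ G s, (Y ^ a) x ∈ G (s - a) := by
    induction a with
    | zero => intro s x hx; simpa using hx
    | succ a ih =>
      intro s x hx
      rw [pow_succ', Module.End.mul_apply]
      have := hY _ _ (ih s x hx)
      rwa [show s - a - 1 = s - (a + 1 : ℕ) by push_cast; ring] at this
  induction n generalizing x with
  | zero =>
    refine ⟨0, fun a => ⟨Submodule.zero_mem _, map_zero _⟩, by simpa using hn⟩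
  | succ n ih =>
    by_cases hni : ((n + 1 : ℕ) : ℤ) ≤ i₀ + 2 * s
    · refine ⟨0, fun a => ⟨Submodule.zero_mem _, map_zero _⟩, ?_⟩
      simpa using t.eq_zero_of_Y_pow hni (hH s x hx) hn
    obtain ⟨m, hm⟩ : ∃ m : ℕ, (m : ℤ) = 2 * n - (i₀ + 2 * s) :=
      ⟨(2 * n - (i₀ + 2 * s)).toNat, by omega⟩
    have hy : (Y ^ n) x ∈ G (s - n) := hYp n s x hx
    have hYy : Y ((Y ^ n) x) = 0 := by rwa [pow_succ', Module.End.mul_apply] at hn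
    have hHy : Hh ((Y ^ n) x) = (-m : ℂ) • (Y ^ n) x := by
      rw [hH _ _ hy, show i₀ + 2 * (s - n) = -(m : ℤ) by omega]; push_cast; rfl
    obtain ⟨c, hc, e⟩ := t.exists_Y_pow_X_pow hHy hYy n 0 (by omega)
    have hc' : (c : ℂ) ≠ 0 := by exact_mod_cast hc.ne'
    rw [add_zero, pow_zero, Module.End.one_apply] at e
    have hmem : (X ^ n) ((c : ℂ)⁻¹ • (Y ^ n) x) ∈ G s := by
      have := hXp n _ _ (Submodule.smul_mem _ (c : ℂ)⁻¹ hy)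
      rwa [sub_add_cancel] at this
    obtain ⟨u, hu, hsum⟩ := ih (Submodule.sub_mem _ hx hmem)
      (by rw [map_sub, map_smul, map_smul, e, smul_smul, inv_mul_cancel₀ hc', one_smul, sub_self])
    refine ⟨Function.update u n ((c : ℂ)⁻¹ • (Y ^ n) x), fun a => ?_, ?_⟩
    · rcases eq_or_ne a n with rfl | ha
      · rw [Function.update_self]
        exact ⟨Submodule.smul_mem _ _ hy, by rw [map_smul, hYy, smul_zero]⟩
      · rw [Function.update_of_ne ha]
        exact hu a
    · rw [Finset.sum_range_succ, Function.update_self]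
      rw [sub_eq_iff_eq_add] at hsum
      refine hsum.trans (congrArg (· + _) ?_)
      refine Finset.sum_congr rfl fun a ha => ?_
      rw [Function.update_of_ne (Finset.mem_range.1 ha).ne]

open scoped ComplexOrder in
theorem weylElement_form_pos {B : V →ₗ[ℂ] V →ₗ⋆[ℂ] ℂ} (hBX : ∀ x y, B (X x) y = B x (X y))
    (hBY : ∀ x y, B (Y x) y = B x (Y y)) {T : Module.End ℂ V} (hTX : Commute X T)
    (hTY : Commute Y T) {G : ℤ → Submodule ℂ V} {i₀ q₀ : ℤ}
    (hX : ∀ s, ∀ x ∈ G s, X x ∈ G (s + 1)) (hY : ∀ s, ∀ x ∈ G s, Y x ∈ G (s - 1))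
    (hH : ∀ s, ∀ x ∈ G s, Hh x = ((i₀ + 2 * s : ℤ) : ℂ) • x)
    (hlow : ∀ (s : ℤ) (m : ℕ), i₀ + 2 * s = -m → ∀ u ∈ G s, Y u = 0 → (X ^ (m + 1)) u = 0 →
      u ≠ 0 → 0 < (-1 : ℂ) ^ (q₀ + s) * B (T ((X ^ m) u)) u)
    (s : ℤ) {x : V} (hx : x ∈ G s) (hx0 : x ≠ 0) :
    0 < (-1 : ℂ) ^ (q₀ + s) * B (T (weylElement X Y x)) x := by
  have hTH : Commute Hh T := by
    have h : Hh = X * Y - Y * X := by rw [t.commutator]; abel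
    rw [h]
    exact (hTX.mul_left hTY).sub_left (hTY.mul_left hTX)
  have hBXp (n : ℕ) (x y : V) : B ((X ^ n) x) y = B x ((X ^ n) y) := by
    induction n generalizing x with
    | zero => rfl
    | succ n ih => rw [pow_succ, Module.End.mul_apply, ih, hBX, ← Module.End.mul_apply, ← pow_succ',
        pow_succ]
  have hBYp (n : ℕ) (x y : V) : B ((Y ^ n) x) y = B x ((Y ^ n) y) := by
    induction n generalizing x with
    | zero => rfl
    | succ n ih => rw [pow_succ, Module.End.mul_apply, ih, hBY, ← Module.End.mul_apply, ← pow_succ',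
        pow_succ]
  obtain ⟨N, hN⟩ := t.nilpotent_Y
  obtain ⟨u, hu, hsum⟩ := t.exists_lowest_decomposition hX hY hH N hx
    (by rw [hN, LinearMap.zero_apply])
  have hHu (a : ℕ) := hH _ _ (hu a).1
  have hTW (a : ℕ) (v : V) : T (weylElement X Y ((X ^ a) v))
      = (-1 : ℂ) ^ a • (Y ^ a) (T (weylElement X Y v)) := by
    rw [t.weylElement_apply_X_pow, map_smul, ← Module.End.mul_apply T, ← (hTY.pow_left a).eq,
      Module.End.mul_apply]
  have off (a b : ℕ) (hab : b ≠ a) :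
      B (T (weylElement X Y ((X ^ a) (u a)))) ((X ^ b) (u b)) = 0 := by
    rw [hTW, map_smul, LinearMap.smul_apply]
    rcases lt_or_gt_of_ne hab with h | h
    · rw [hBYp, t.Y_pow_X_pow_of_lt (hHu b) (hu b).2 h, map_zero, smul_zero]
    · have hz : X (T (weylElement X Y (u a))) = 0 := by
        have e := LinearMap.congr_fun t.weylElement_mul_Y (u a)
        simp only [Module.End.mul_apply, (hu a).2, map_zero, LinearMap.neg_apply] at e
        rw [← Module.End.mul_apply, hTX.eq, Module.End.mul_apply, ← neg_eq_zero, ← map_neg, ← e,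
          map_zero]
      have hHz : (-Hh) (T (weylElement X Y (u a)))
          = ((i₀ + 2 * (s - a) : ℤ) : ℂ) • T (weylElement X Y (u a)) := by
        have e := LinearMap.congr_fun t.weylElement_mul_H (u a)
        simp only [Module.End.mul_apply, hHu a, map_smul, LinearMap.neg_apply] at e
        rw [LinearMap.neg_apply, ← Module.End.mul_apply, hTH.eq, Module.End.mul_apply, ← map_neg,
          ← e, map_smul]
      rw [← hBXp, t.symm.Y_pow_X_pow_of_lt hHz hz h, map_zero, LinearMap.zero_apply, smul_zero]
  have diag (a : ℕ) (ha : (X ^ a) (u a) ≠ 0) : 0 < (-1 : ℂ) ^ (q₀ + s) *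
      B (T (weylElement X Y ((X ^ a) (u a)))) ((X ^ a) (u a)) := by
    have hu0 : u a ≠ 0 := fun h => ha (by rw [h, map_zero])
    obtain ⟨m, hm⟩ : ∃ m : ℕ, i₀ + 2 * (s - a) = -m := by
      by_contra! hne
      refine hu0 (t.eq_zero_of_Y_pow (n := 1) ?_ (hHu a) (by rw [pow_one]; exact (hu a).2))
      have := hne (-(i₀ + 2 * (s - a))).toNat
      omega
    have hHm : Hh (u a) = (-m : ℂ) • u a := by rw [hHu a, hm]; push_cast; rfl
    have hXm := t.X_pow_succ_eq_zero hHm (hu a).2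
    have ham : a ≤ m := by
      by_contra! hlt
      refine ha ?_
      rw [show a = a - (m + 1) + (m + 1) by omega, pow_add, Module.End.mul_apply,
        show a - (m + 1) + (m + 1) = a by omega, hXm, map_zero]
    obtain ⟨c, hc, e⟩ := t.exists_Y_pow_X_pow hHm (hu a).2 a 0 (by omega)
    rw [add_zero, pow_zero, Module.End.one_apply] at e
    have hpos := hlow _ m hm _ (hu a).1 (hu a).2 hXm hu0
    have hcm : (0 : ℂ) < ((c * (m.factorial : ℝ)⁻¹ : ℝ) : ℂ) := by
      rw [Complex.zero_lt_real]
      positivity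
    convert! mul_pos hcm hpos using 1
    rw [hTW, map_smul, LinearMap.smul_apply, hBYp, e, LinearMap.map_smulₛₗ,
      Complex.conj_ofReal, t.weylElement_apply_of_Y_eq_zero hHm (hu a).2, map_smul T, map_smul B,
      LinearMap.smul_apply]
    rw [show q₀ + s = q₀ + (s - a) + (a : ℤ) by ring, zpow_add₀ (by norm_num) _ (a : ℤ),
      zpow_natCast]
    have hsign : (-1 : ℂ) ^ a * (-1) ^ a = 1 := by rw [← mul_pow]; simp
    simp only [smul_eq_mul]
    push_cast
    linear_combination ((c : ℂ) * (m.factorial : ℂ)⁻¹ * ((-1 : ℂ) ^ (q₀ + (s - a)) *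
      B (T ((X ^ m) (u a))) (u a))) * hsign
  have expand : (-1 : ℂ) ^ (q₀ + s) * B (T (weylElement X Y x)) x = ∑ a ∈ Finset.range N,
      (-1 : ℂ) ^ (q₀ + s) * B (T (weylElement X Y ((X ^ a) (u a)))) ((X ^ a) (u a)) := by
    rw [← Finset.mul_sum]
    congr 1
    conv_lhs => rw [hsum]
    simp only [map_sum, LinearMap.sum_apply]
    rw [Finset.sum_comm]
    refine Finset.sum_congr rfl fun a ha => ?_
    exact Finset.sum_eq_single_of_mem a ha fun b _ hb => off a b hb
  rw [expand]
  refine Finset.sum_pos' (fun a _ => ?_) ?_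
  · rcases eq_or_ne ((X ^ a) (u a)) 0 with h | h
    · rw [h, map_zero, mul_zero]
    · exact (diag a h).le
  · by_contra! hne
    refine hx0 (hsum.trans (Finset.sum_eq_zero fun a ha => ?_))
    by_contra h
    exact hne a ha (diag a h)

end IsNilpotentSL2Triple

theorem isNilpotent_of_map_le {ι : Type*} {f : ι → Submodule ℂ V} (hf : iSup f = ⊤)
    (hfin : {t | f t ≠ ⊥}.Finite) {φ : ι → ℤ} {σ : ι → ι} (hσ : ∀ t, φ (σ t) = φ t + 1)
    {A : Module.End ℂ V} (hA : ∀ t, (f t).map A ≤ f (σ t)) : IsNilpotent A := by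
  obtain ⟨b, hb⟩ := (hfin.image φ).bddAbove
  obtain ⟨a, ha⟩ := (hfin.image φ).bddBelow
  have hpow (n : ℕ) : ∀ t, ∀ x ∈ f t, ∃ t', φ t' = φ t + n ∧ (A ^ n) x ∈ f t' := by
    induction n with
    | zero => exact fun t x hx => ⟨t, by simp, hx⟩
    | succ n ih =>
      intro t x hx
      obtain ⟨t', ht', hx'⟩ := ih t x hx
      refine ⟨σ t', by rw [hσ, ht']; push_cast; ring, ?_⟩
      rw [pow_succ', Module.End.mul_apply]
      exact hA t' (Submodule.mem_map_of_mem hx')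
  refine ⟨(b - a + 1).toNat, ?_⟩
  rw [← LinearMap.ker_eq_top, eq_top_iff, ← hf]
  refine iSup_le fun t x hx => ?_
  rw [LinearMap.mem_ker]
  by_cases ht : f t = ⊥
  · rw [ht, Submodule.mem_bot] at hx
    rw [hx, map_zero]
  obtain ⟨t', ht', hx'⟩ := hpow (b - a + 1).toNat t x hx
  have h' : f t' = ⊥ := by
    by_contra h
    have h1 := hb (Set.mem_image_of_mem φ h)
    have h2 := ha (Set.mem_image_of_mem φ ht)
    omega
  rwa [h', Submodule.mem_bot] at hx'

end Representation

namespace IsBiSL2HodgeStructure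

variable {w : ℤ} {Q : ℤ → ℤ → ℤ → ℤ → Submodule ℂ H} {X₁ H₁ Y₁ X₂ H₂ Y₂ : Module.End ℂ H}
  (hQ : IsBiSL2HodgeStructure w Q X₁ H₁ Y₁ X₂ H₂ Y₂)
include hQ

theorem iSup_eq_top : ⨆ t : (ℤ × ℤ) × ℤ × ℤ, Q t.1.1 t.1.2 t.2.1 t.2.2 = ⊤ :=
  hQ.internal.submodule_iSup_eq_top

theorem triple₁ : IsNilpotentSL2Triple X₁ H₁ Y₁ where
  weight_X := by rw [two_mul, ← two_smul ℂ X₁, ← hQ.lie_HX₁]; abel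
  weight_Y := by rw [two_mul, ← two_smul ℂ Y₁, sub_eq_add_neg, ← neg_smul, ← hQ.lie_HY₁]; abel
  commutator := by rw [← sub_eq_iff_eq_add']; exact hQ.lie_XY₁
  nilpotent_X := isNilpotent_of_map_le hQ.iSup_eq_top hQ.finite (φ := fun t => t.2.1)
    (σ := fun t => ((t.1.1 + 2, t.1.2), t.2.1 + 1, t.2.2 + 1)) (fun _ => rfl)
    (fun _ => hQ.mapX₁ _ _ _ _)
  nilpotent_Y := isNilpotent_of_map_le hQ.iSup_eq_top hQ.finite (φ := fun t => -t.2.1)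
    (σ := fun t => ((t.1.1 - 2, t.1.2), t.2.1 - 1, t.2.2 - 1)) (fun _ => by ring)
    (fun _ => hQ.mapY₁ _ _ _ _)

theorem triple₂ : IsNilpotentSL2Triple X₂ H₂ Y₂ where
  weight_X := by rw [two_mul, ← two_smul ℂ X₂, ← hQ.lie_HX₂]; abel
  weight_Y := by rw [two_mul, ← two_smul ℂ Y₂, sub_eq_add_neg, ← neg_smul, ← hQ.lie_HY₂]; abel
  commutator := by rw [← sub_eq_iff_eq_add']; exact hQ.lie_XY₂
  nilpotent_X := isNilpotent_of_map_le hQ.iSup_eq_top hQ.finite (φ := fun t => t.2.1)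
    (σ := fun t => ((t.1.1, t.1.2 + 2), t.2.1 + 1, t.2.2 + 1)) (fun _ => rfl)
    (fun _ => hQ.mapX₂ _ _ _ _)
  nilpotent_Y := isNilpotent_of_map_le hQ.iSup_eq_top hQ.finite (φ := fun t => -t.2.1)
    (σ := fun t => ((t.1.1, t.1.2 - 2), t.2.1 - 1, t.2.2 - 1)) (fun _ => by ring)
    (fun _ => hQ.mapY₂ _ _ _ _)

theorem commute_XX : Commute X₁ X₂ := hQ.comm _ (by simp) _ (by simp)
theorem commute_XH : Commute X₁ H₂ := hQ.comm _ (by simp) _ (by simp)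
theorem commute_XY : Commute X₁ Y₂ := hQ.comm _ (by simp) _ (by simp)
theorem commute_HX : Commute H₁ X₂ := hQ.comm _ (by simp) _ (by simp)
theorem commute_HY : Commute H₁ Y₂ := hQ.comm _ (by simp) _ (by simp)
theorem commute_YX : Commute Y₁ X₂ := hQ.comm _ (by simp) _ (by simp)
theorem commute_YH : Commute Y₁ H₂ := hQ.comm _ (by simp) _ (by simp)
theorem commute_YY : Commute Y₁ Y₂ := hQ.comm _ (by simp) _ (by simp)

theorem triple_add : IsNilpotentSL2Triple (X₁ + X₂) (H₁ + H₂) (Y₁ + Y₂) where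
  weight_X := by
    have e : (H₁ + H₂) * (X₁ + X₂) = H₁ * X₁ + H₁ * X₂ + H₂ * X₁ + H₂ * X₂ := by noncomm_ring
    rw [e, hQ.commute_HX.eq, ← hQ.commute_XH.eq, hQ.triple₁.weight_X, hQ.triple₂.weight_X]
    noncomm_ring
  weight_Y := by
    have e : (H₁ + H₂) * (Y₁ + Y₂) = H₁ * Y₁ + H₁ * Y₂ + H₂ * Y₁ + H₂ * Y₂ := by noncomm_ring
    rw [e, hQ.commute_HY.eq, ← hQ.commute_YH.eq, hQ.triple₁.weight_Y, hQ.triple₂.weight_Y]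
    noncomm_ring
  commutator := by
    have e : (X₁ + X₂) * (Y₁ + Y₂) = X₁ * Y₁ + X₁ * Y₂ + X₂ * Y₁ + X₂ * Y₂ := by noncomm_ring
    rw [e, hQ.commute_XY.eq, ← hQ.commute_YX.eq, hQ.triple₁.commutator, hQ.triple₂.commutator]
    noncomm_ring
  nilpotent_X := hQ.commute_XX.isNilpotent_add hQ.triple₁.nilpotent_X hQ.triple₂.nilpotent_X
  nilpotent_Y := hQ.commute_YY.isNilpotent_add hQ.triple₁.nilpotent_Y hQ.triple₂.nilpotent_Y

omit hQ in
theorem le_iSup_total {i j k p q : ℤ} (h : i + j = k) : Q i j p q ≤ ⨆ i : ℤ, Q i (k - i) p q :=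
  le_iSup_of_le i (by rw [← h, add_sub_cancel_left])

theorem total_internal : DirectSum.IsInternal
    (fun t : ℤ × ℤ × ℤ => ⨆ i : ℤ, Q i (t.1 - i) t.2.1 t.2.2) := by
  refine DirectSum.isInternal_submodule_of_iSupIndep_of_iSup_eq_top (fun t => ?_) ?_
  · refine (hQ.internal.submodule_iSupIndep.disjoint_biSup_biSup
      (s := {s | (s.1.1 + s.1.2, s.2) = t}) (t := {s | (s.1.1 + s.1.2, s.2) ≠ t}) ?_).mono ?_ ?_
    · exact Set.disjoint_left.2 fun s h h' => h' h
    · exact iSup_le fun i => le_iSup₂_of_le ((i, t.1 - i), t.2) (by simp) le_rfl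
    · exact iSup₂_le fun t' ht' => iSup_le fun i =>
        le_iSup₂_of_le ((i, t'.1 - i), t'.2) (by simpa using ht') le_rfl
  · rw [eq_top_iff, ← hQ.iSup_eq_top]
    exact iSup_le fun s => le_iSup_of_le (s.1.1 + s.1.2, s.2) (le_iSup_total rfl)

omit hQ in
theorem exists_ne_bot_of_total {k p q : ℤ} (h : ⨆ i : ℤ, Q i (k - i) p q ≠ ⊥) :
    ∃ i, Q i (k - i) p q ≠ ⊥ := by
  by_contra! h'
  exact h (iSup_eq_bot.2 h')

theorem total_isSL2HodgeStructure :
    IsSL2HodgeStructure w (fun k p q => ⨆ i : ℤ, Q i (k - i) p q)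
      (X₁ + X₂) (H₁ + H₂) (Y₁ + Y₂) where
  internal := hQ.total_internal
  finite := by
    refine (hQ.finite.image fun s => (s.1.1 + s.1.2, s.2)).subset fun t ht => ?_
    obtain ⟨i, hi⟩ := exists_ne_bot_of_total ht
    exact ⟨((i, t.1 - i), t.2), hi, by simp⟩
  weight k p q h := by
    obtain ⟨i, hi⟩ := exists_ne_bot_of_total h
    have := hQ.weight _ _ _ _ hi
    omega
  lie_HX := by rw [hQ.triple_add.weight_X, two_smul, two_mul]; abel
  lie_HY := by rw [hQ.triple_add.weight_Y, neg_smul, two_smul, two_mul]; abel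
  lie_XY := by rw [hQ.triple_add.commutator]; abel
  semisimple k p q x hx := by
    induction hx using Submodule.iSup_induction' with
    | mem i x hx =>
      rw [LinearMap.add_apply, hQ.semisimple₁ _ _ _ _ x hx, hQ.semisimple₂ _ _ _ _ x hx]
      push_cast
      module
    | zero => simp
    | add x y _ _ ihx ihy => rw [map_add, ihx, ihy, smul_add]
  mapX k p q := by
    rw [Submodule.map_iSup]
    refine iSup_le fun i => (Submodule.map_add_le _ _ _).trans (sup_le ?_ ?_)
    · exact (hQ.mapX₁ _ _ _ _).trans (le_iSup_total (by ring))
    · exact (hQ.mapX₂ _ _ _ _).trans (le_iSup_total (by ring))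
  mapY k p q := by
    rw [Submodule.map_iSup]
    refine iSup_le fun i => (Submodule.map_add_le _ _ _).trans (sup_le ?_ ?_)
    · exact (hQ.mapY₁ _ _ _ _).trans (le_iSup_total (by ring))
    · exact (hQ.mapY₂ _ _ _ _).trans (le_iSup_total (by ring))

end IsBiSL2HodgeStructure

namespace IsBiSL2Polarization

variable {w : ℤ} {Q : ℤ → ℤ → ℤ → ℤ → Submodule ℂ H} {X₁ H₁ Y₁ X₂ H₂ Y₂ : Module.End ℂ H}
  {S : H → H → ℂ} (hS : IsBiSL2Polarization w Q X₁ H₁ Y₁ X₂ H₂ Y₂ S)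
  (hQ : IsBiSL2HodgeStructure w Q X₁ H₁ Y₁ X₂ H₂ Y₂)

attribute [local instance] endModuleRat

/-- The polarization as a sesquilinear map. -/
def form : H →ₗ[ℂ] H →ₗ⋆[ℂ] ℂ :=
  LinearMap.mk₂'ₛₗ (RingHom.id ℂ) (starRingEnd ℂ) S hS.add_left hS.smul_left hS.add_right
    hS.smul_right

theorem form_apply (x y : H) : hS.form x y = S x y := rfl

include hS

theorem total_orth (j p q j' p' q' : ℤ) (h : j + j' ≠ 0 ∨ p + q' ≠ w ∨ q + p' ≠ w)
    {x y : H} (hx : x ∈ ⨆ i : ℤ, Q i (j - i) p q) (hy : y ∈ ⨆ i : ℤ, Q i (j' - i) p' q') :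
    S x y = 0 := by
  rw [← hS.form_apply]
  induction hx using Submodule.iSup_induction' with
  | zero => simp
  | add x x' _ _ ihx ihx' => rw [map_add, LinearMap.add_apply, ihx, ihx', add_zero]
  | mem i x hx =>
    induction hy using Submodule.iSup_induction' with
    | zero => simp
    | add y y' _ _ ihy ihy' => rw [map_add, ihy, ihy', add_zero]
    | mem i' y hy => exact hS.orth i (j - i) p q i' (j' - i') p' q' (by omega) x hx y hy

open scoped ComplexOrder

include hQ in
theorem weylElement_form_pos (i j p q : ℤ) {x : H} (hx : x ∈ Q i j p q) (hx0 : x ≠ 0) :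
    0 < (-1 : ℂ) ^ q * hS.form (weylElement X₂ Y₂ (weylElement X₁ Y₁ x)) x := by
  have hW₂X₁ : Commute X₁ (weylElement X₂ Y₂) :=
    (weylElement_commute hQ.commute_XX.symm hQ.commute_XY.symm).symm
  have hW₂Y₁ : Commute Y₁ (weylElement X₂ Y₂) :=
    (weylElement_commute hQ.commute_YX.symm hQ.commute_YY.symm).symm
  have key := hQ.triple₁.weylElement_form_pos (B := hS.form) hS.adj_X₁ hS.adj_Y₁ hW₂X₁ hW₂Y₁
    (G := fun s => Q (i + 2 * s) j (p + s) (q + s)) (i₀ := i) (q₀ := q) ?_ ?_ ?_ ?_ 0 (x := x)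
    (by simpa using hx) hx0
  · simpa using key
  · intro s x hx
    have := hQ.mapX₁ _ _ _ _ (Submodule.mem_map_of_mem hx)
    convert this using 2 <;> ring
  · intro s x hx
    have := hQ.mapY₁ _ _ _ _ (Submodule.mem_map_of_mem hx)
    convert this using 2 <;> ring
  · intro s x hx
    exact hQ.semisimple₁ _ _ _ _ x hx
  intro s m hm u hu _ hXu hu0
  rw [← Module.End.mul_apply, ← (hW₂X₁.pow_left m).eq, Module.End.mul_apply]
  have hX₂ker {x : H} (hx : (X₁ ^ (m + 1)) x = 0) : (X₁ ^ (m + 1)) (X₂ x) = 0 := by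
    rw [← Module.End.mul_apply, (hQ.commute_XX.pow_left _).eq, Module.End.mul_apply, hx, map_zero]
  have hY₂ker {x : H} (hx : (X₁ ^ (m + 1)) x = 0) : (X₁ ^ (m + 1)) (Y₂ x) = 0 := by
    rw [← Module.End.mul_apply, (hQ.commute_XY.pow_left _).eq, Module.End.mul_apply, hx, map_zero]
  have key := hQ.triple₂.weylElement_form_pos (B := hS.form) hS.adj_X₂ hS.adj_Y₂
    (hQ.commute_XX.symm.pow_right m) (hQ.commute_XY.symm.pow_right m)
    (G := fun r => Q (-m) (j + 2 * r) (p + s + r) (q + s + r) ⊓ LinearMap.ker (X₁ ^ (m + 1)))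
    (i₀ := j) (q₀ := q + s) ?_ ?_ ?_ ?_ 0 (x := u)
    (by simpa [hXu, ← hm] using hu) hu0
  · simpa using key
  · intro r x hx
    have := hQ.mapX₂ _ _ _ _ (Submodule.mem_map_of_mem hx.1)
    refine Submodule.mem_inf.2 ⟨?_, hX₂ker hx.2⟩
    convert this using 2 <;> ring
  · intro r x hx
    have := hQ.mapY₂ _ _ _ _ (Submodule.mem_map_of_mem hx.1)
    refine Submodule.mem_inf.2 ⟨?_, hY₂ker hx.2⟩
    convert this using 2 <;> ring
  · intro r x hx
    exact hQ.semisimple₂ _ _ _ _ x hx.1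
  intro r n hn v hv _ hXv hv0
  rw [hn] at hv
  obtain ⟨c, hc, e⟩ := hS.posdef m n _ _ v hv.1 hv.2 hXv hv0
  rw [Module.End.mul_apply] at e
  rw [hS.form_apply, e]
  exact Complex.zero_lt_real.2 hc

include hQ in
theorem total_posdef (k : ℕ) (p q : ℤ) {x : H} (hx : x ∈ ⨆ i : ℤ, Q i (-(k : ℤ) - i) p q)
    (hX : ((X₁ + X₂) ^ (k + 1)) x = 0) (hx0 : x ≠ 0) :
    0 < (-1 : ℂ) ^ q * S (((X₁ + X₂) ^ k) x) x := by
  have hHx : (H₁ + H₂) x = (-k : ℂ) • x := by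
    rw [hQ.total_isSL2HodgeStructure.semisimple _ _ _ x hx]; push_cast; rfl
  have hW := hQ.triple_add.weylElement_apply_of_Y_eq_zero hHx
    (hQ.triple_add.Y_eq_zero_of_X_pow_succ hHx hX)
  rw [add_comm X₁, add_comm Y₁, weylElement_add hQ.commute_XX.symm hQ.commute_YY.symm
    hQ.commute_YX.symm hQ.commute_XY.symm hQ.triple₂.nilpotent_X hQ.triple₁.nilpotent_X
    hQ.triple₂.nilpotent_Y hQ.triple₁.nilpotent_Y, Module.End.mul_apply, add_comm X₂] at hW
  obtain ⟨f, hf, hsum⟩ := (Submodule.mem_iSup_iff_exists_finsupp _ _).1 hx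
  rw [Finsupp.sum] at hsum
  set W := weylElement X₂ Y₂ * weylElement X₁ Y₁ with hWdef
  have hHW : H₁ * W = -(W * H₁) := by
    rw [hWdef, ← mul_assoc, ← (weylElement_commute hQ.commute_HX.symm hQ.commute_HY.symm).eq,
      mul_assoc, mul_assoc, hQ.triple₁.weylElement_mul_H, mul_neg, neg_neg]
  have off (a b : ℤ) (hab : b ≠ a) : hS.form (W (f a)) (f b) = 0 := by
    have h1 := hS.adj_H₁ (W (f a)) (f b)
    have h2 := LinearMap.congr_fun hHW (f a)
    simp only [Module.End.mul_apply, LinearMap.neg_apply] at h2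
    rw [h2, hQ.semisimple₁ _ _ _ _ _ (hf a), hQ.semisimple₁ _ _ _ _ _ (hf b), map_smul,
      ← neg_smul, hS.smul_left, hS.smul_right, map_intCast] at h1
    have h3 : ((b - a : ℤ) : ℂ) * S (W (f a)) (f b) = 0 := by
      push_cast
      linear_combination h1
    exact (mul_eq_zero.1 h3).resolve_left (by exact_mod_cast sub_ne_zero.2 hab)
  have diag (a : ℤ) (ha : f a ≠ 0) : 0 < (-1 : ℂ) ^ q * hS.form (W (f a)) (f a) :=
    hS.weylElement_form_pos hQ _ _ _ _ (hf a) ha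
  have expand : (-1 : ℂ) ^ q * hS.form (W x) x
      = ∑ a ∈ f.support, (-1 : ℂ) ^ q * hS.form (W (f a)) (f a) := by
    rw [← Finset.mul_sum]
    congr 1
    conv_lhs => rw [← hsum]
    simp only [map_sum, LinearMap.sum_apply]
    rw [Finset.sum_comm]
    exact Finset.sum_congr rfl fun a ha => Finset.sum_eq_single_of_mem a ha fun b _ hb => off a b hb
  have hpos : 0 < (-1 : ℂ) ^ q * hS.form (W x) x := by
    rw [expand]
    refine Finset.sum_pos (fun a ha => diag a (Finsupp.mem_support_iff.1 ha)) ?_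
    rw [Finset.nonempty_iff_ne_empty]
    intro h
    rw [h, Finset.sum_empty] at hsum
    exact hx0 hsum.symm
  have hk : (0 : ℂ) < (k.factorial : ℂ) := by exact_mod_cast k.factorial_pos
  convert! mul_pos hk hpos using 1
  rw [hWdef, Module.End.mul_apply, hW, map_smul, LinearMap.smul_apply, smul_eq_mul, hS.form_apply]
  field_simp

include hQ in
theorem total_isSL2Polarization :
    IsSL2Polarization w (fun k p q => ⨆ i : ℤ, Q i (k - i) p q)
      (X₁ + X₂) (H₁ + H₂) (Y₁ + Y₂) S where
  add_left := hS.add_left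
  smul_left := hS.smul_left
  add_right := hS.add_right
  smul_right := hS.smul_right
  hermitian := hS.hermitian
  adj_H x y := by
    rw [LinearMap.add_apply, LinearMap.add_apply, hS.add_left, hS.add_right, hS.adj_H₁, hS.adj_H₂]
    ring
  adj_X x y := by
    rw [LinearMap.add_apply, LinearMap.add_apply, hS.add_left, hS.add_right, hS.adj_X₁, hS.adj_X₂]
  adj_Y x y := by
    rw [LinearMap.add_apply, LinearMap.add_apply, hS.add_left, hS.add_right, hS.adj_Y₁, hS.adj_Y₂]
  orth j p q j' p' q' h _ hx _ hy := hS.total_orth j p q j' p' q' h hx hy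
  posdef k p q x hx hX hx0 := by
    have h := hS.total_posdef hQ k p q hx hX hx0
    obtain ⟨hre, him⟩ := Complex.lt_def.1 h
    exact ⟨_, hre, Complex.ext rfl him.symm⟩

end IsBiSL2Polarization

/-- Let `(ℋ, F', F'', (X₁,H₁,Y₁), (X₂,H₂,Y₂))` be a bi-sl₂-Hodge structure
of central weight `w` on a finite-dimensional ℂ-vector space, polarized by a sesquilinear
form `S`.  Then `(X₁+X₂, H₁+H₂, Y₁+Y₂)` is again an sl₂-triple, it defines an sl₂-Hodge
structure of central weight `w` on `ℋ` whose grading is the total grading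
`ℋ^k = ⊕_{i+j=k} ℋ_{i,j}` (with `(p,q)`-pieces `⊕_{i+j=k} ℋ_{i,j}^{p,q}`), and `S`
polarizes this sl₂-Hodge structure. -/
theorem bi_sl2_hodge_gives_sl2_hodge
    [FiniteDimensional ℂ H] (w : ℤ)
    (Q : ℤ → ℤ → ℤ → ℤ → Submodule ℂ H)
    (X₁ H₁ Y₁ X₂ H₂ Y₂ : Module.End ℂ H) (S : H → H → ℂ)
    (hbi : IsBiSL2HodgeStructure w Q X₁ H₁ Y₁ X₂ H₂ Y₂)
    (hpol : IsBiSL2Polarization w Q X₁ H₁ Y₁ X₂ H₂ Y₂ S) :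
    IsSL2HodgeStructure w (fun k p q => ⨆ i : ℤ, Q i (k - i) p q)
      (X₁ + X₂) (H₁ + H₂) (Y₁ + Y₂) ∧
    IsSL2Polarization w (fun k p q => ⨆ i : ℤ, Q i (k - i) p q)
      (X₁ + X₂) (H₁ + H₂) (Y₁ + Y₂) S := by
  exact ⟨hbi.total_isSL2HodgeStructure, hpol.total_isSL2Polarization hbi⟩
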